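/- arXiv:2605.28311 — 6 statements merged into one kernel-verified Lean document; each statement's English description precedes it below -/
import Mathlib

section
/- Let X be a Banach space, let x ∈ X, and let (x_i)_{i∈ω} and (y_i)_{i∈ω} be bounded sequences in X such that x = ½(x_i + y_i) for all i ∈ ω. Then for every weak neighborhood V of x there exists an infinite subset I of ω such that ½(x_i + y_j) ∈ V for all i, j ∈ I. In particular, x belongs to the weak closure of the set {½(x_i + y_j) : i ≠ j ∈ ω}. -/
open Metric Set Topology

noncomputable section

/-- Transfinite iteration of a derivation `d` starting from `a`;
meets are taken at limit stages. -/
def derivIter {L : Type*} [CompleteLattice L] (d : L → L) (a : L) (α : Ordinal) : L :=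
  Ordinal.limitRecOn α a (fun _ ih => d ih) (fun o _ ih => ⨅ (γ : Ordinal) (h : γ < o), ih γ h)

/-- The weak topology of a real normed space. -/
def weakTop (X : Type*) [NormedAddCommGroup X] [NormedSpace ℝ X] : TopologicalSpace X :=
  TopologicalSpace.induced (fun (x : X) (f : X →L[ℝ] ℝ) => f x) inferInstance

variable {X : Type*} [NormedAddCommGroup X] [NormedSpace ℝ X]

/-- The dentability derivation `d_ε^1`. -/
def dentDeriv (ε : ℝ) (C : Set X) : Set X :=
  C \ ⋃ (f : X →L[ℝ] ℝ) (a : ℝ) (_ : Metric.diam ({y | a < f y} ∩ C) < ε), {y | a < f y}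

/-- The weak fragmentation derivation `σ_ε^1`. -/
def weakDeriv (ε : ℝ) (C : Set X) : Set X :=
  C \ ⋃ (V : Set X) (_ : IsOpen[weakTop X] V) (_ : Metric.diam (V ∩ C) < ε), V

/-- The convex weak fragmentation derivation `γ_ε^1`. -/
def convDeriv (ε : ℝ) (C : Set X) : Set X :=
  closure (convexHull ℝ (weakDeriv ε C))

/-- `treeRoot C δ α x` : `x` is the root of a `δ`-`α`-tree contained in `C`. -/
def treeRoot (C : Set X) (δ : ℝ) (α : Ordinal) : X → Prop :=
  Ordinal.limitRecOn α (fun x => x ∈ C)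
    (fun _ ih x => x ∈ C ∧ ∃ y z : X,
      x = (2⁻¹ : ℝ) • (y + z) ∧ δ ≤ 2⁻¹ * ‖y - z‖ ∧ ih y ∧ ih z)
    (fun o _ ih x => ∀ γ (h : γ < o), ih γ h x)

/-- `sprawlRoot C δ α x` : `x` is the root of a `δ`-`α`-sprawling tree contained in `C`. -/
def sprawlRoot (C : Set X) (δ : ℝ) (α : Ordinal) : X → Prop :=
  Ordinal.limitRecOn α (fun x => x ∈ C)
    (fun _ ih x => x ∈ C ∧ ∃ y z : ℕ → X,
      (∀ n, x = (2⁻¹ : ℝ) • (y n + z n)) ∧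
      (∀ n m, n ≠ m → δ ≤ ‖y n - y m‖) ∧
      (∀ n, ih (y n)) ∧ (∀ n, ih (z n)))
    (fun o _ ih x => ∀ γ (h : γ < o), ih γ h x)

/-- `bushRoot C δ α x` : `x` is the root of a `δ`-`α`-bush contained in `C`. -/
def bushRoot (C : Set X) (δ : ℝ) (α : Ordinal) : X → Prop :=
  Ordinal.limitRecOn α (fun x => x ∈ C)
    (fun _ ih x => x ∈ C ∧ ∃ (n : ℕ) (y : Fin (n + 1) → X) (lam : Fin (n + 1) → ℝ),
      (∀ i, 0 < lam i ∧ lam i ≤ 1) ∧ (∑ i, lam i = 1) ∧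
      x = ∑ i, lam i • y i ∧ (∀ i, δ ≤ ‖x - y i‖) ∧ ∀ i, ih (y i))
    (fun o _ ih x => ∀ γ (h : γ < o), ih γ h x)

/-- `X` has the Slice Point of Continuity Property. -/
def SlicePCP (X : Type*) [NormedAddCommGroup X] [NormedSpace ℝ X] : Prop :=
  ∀ A : Set X, A.Nonempty → Bornology.IsBounded A → ∀ ε > (0 : ℝ),
    ∃ (f : X →L[ℝ] ℝ) (a : ℝ), ({y | a < f y} ∩ A).Nonempty ∧
      ∀ x ∈ {y | a < f y} ∩ A, ∃ V ∈ @nhds X (weakTop X) x, Metric.diam (V ∩ A) < ε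

/-- If `u` is bounded and every pair `(uᵢ, vᵢ)` has midpoint `x`, then the points `½(uᵢ + vⱼ)`
converge weakly to `x` along the square of the hyperfilter. -/
theorem tendsto_half_add_weakTop {X : Type*} [NormedAddCommGroup X] [NormedSpace ℝ X]
    {x : X} {u v : ℕ → X} (hu : Bornology.IsBounded (Set.range u))
    (hmid : ∀ i, x = (2⁻¹ : ℝ) • (u i + v i)) :
    Filter.Tendsto (fun p : ℕ × ℕ => (2⁻¹ : ℝ) • (u p.1 + v p.2))
      ((Filter.hyperfilter ℕ : Filter ℕ) ×ˢ (Filter.hyperfilter ℕ : Filter ℕ))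
      (@nhds X (weakTop X) x) := by
  unfold weakTop
  rw [nhds_induced, Filter.tendsto_comap_iff, tendsto_pi_nhds]
  intro f
  have hb : Bornology.IsBounded (f '' Set.range u) := f.lipschitz.isBounded_image hu
  obtain ⟨l, -, hl⟩ := hb.isCompact_closure.ultrafilter_le_nhds
    ((Filter.hyperfilter ℕ).map fun i => f (u i)) <| by
      rw [Filter.le_principal_iff]
      exact Filter.mem_map.2 <| Filter.univ_mem' fun i =>
        subset_closure (Set.mem_image_of_mem f (Set.mem_range_self i))
  have hl' : Filter.Tendsto (fun i => f (u i)) (Filter.hyperfilter ℕ : Filter ℕ) (𝓝 l) := hl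
  have key : ∀ p : ℕ × ℕ, f ((2⁻¹ : ℝ) • (u p.1 + v p.2)) =
      f x + 2⁻¹ * (f (u p.1) - f (u p.2)) := by
    intro p
    have h := congrArg f (hmid p.2)
    simp only [map_smul, map_add, smul_eq_mul] at h ⊢
    linarith
  have ht := (((hl'.comp Filter.tendsto_fst).sub (hl'.comp Filter.tendsto_snd)).const_mul
    (2⁻¹ : ℝ)).const_add (f x)
  rw [sub_self, mul_zero, add_zero] at ht
  exact ht.congr fun p => (key p).symm

/-- If `x = ½(xᵢ + yᵢ)` for bounded sequences `(xᵢ)`, `(yᵢ)`, then every weak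
neighborhood of `x` contains `½(xᵢ + yⱼ)` for all `i, j` in some infinite `I ⊆ ω`; in particular
`x` is in the weak closure of `{½(xᵢ + yⱼ) : i ≠ j}`. -/
theorem statement0 {X : Type*} [NormedAddCommGroup X] [NormedSpace ℝ X] [CompleteSpace X]
    (x : X) (u v : ℕ → X)
    (hu : Bornology.IsBounded (Set.range u)) (hv : Bornology.IsBounded (Set.range v))
    (hmid : ∀ i, x = (2⁻¹ : ℝ) • (u i + v i)) :
    (∀ V ∈ @nhds X (weakTop X) x, ∃ I : Set ℕ, I.Infinite ∧
        ∀ i ∈ I, ∀ j ∈ I, (2⁻¹ : ℝ) • (u i + v j) ∈ V) ∧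
      x ∈ @closure X (weakTop X) {w | ∃ i j : ℕ, i ≠ j ∧ w = (2⁻¹ : ℝ) • (u i + v j)} := by
  have main : ∀ V ∈ @nhds X (weakTop X) x, ∃ I : Set ℕ, I.Infinite ∧
      ∀ i ∈ I, ∀ j ∈ I, (2⁻¹ : ℝ) • (u i + v j) ∈ V := by
    intro V hV
    obtain ⟨I, hI, hIV⟩ := Filter.mem_prod_self_iff.1 (tendsto_half_add_weakTop hu hmid hV)
    exact ⟨I, fun hfin => Filter.notMem_hyperfilter_of_finite hfin hI,
      fun i hi j hj => hIV (Set.mk_mem_prod hi hj)⟩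
  refine ⟨main, ?_⟩
  rw [@mem_closure_iff_nhds X (weakTop X)]
  intro V hV
  obtain ⟨I, hI, hIV⟩ := main V hV
  obtain ⟨i, hi, j, hj, hij⟩ := hI.nontrivial
  exact ⟨_, hIV i hi j hj, i, j, hij, rfl⟩
end
end

section
/- Let X be a separable Banach space. Then every nonempty bounded subset of X is dentable if and only if D(X) < ω₁ (i.e., for every ε > 0 there exists a countable ordinal α with d_ε^α(B_X) = ∅). -/
open Metric Set Topology

noncomputable section

variable {X : Type*} [NormedAddCommGroup X] [NormedSpace ℝ X]

section DerivIter

variable {L : Type*} [CompleteLattice L] (d : L → L) (a : L)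

lemma derivIter_zero : derivIter d a 0 = a :=
  Ordinal.limitRecOn_zero ..

lemma derivIter_add_one (α : Ordinal) : derivIter d a (α + 1) = d (derivIter d a α) :=
  Ordinal.limitRecOn_add_one ..

lemma derivIter_limit {o : Ordinal} (ho : Order.IsSuccLimit o) :
    derivIter d a o = ⨅ (γ : Ordinal) (_ : γ < o), derivIter d a γ :=
  Ordinal.limitRecOn_limit _ _ _ _ ho

lemma derivIter_antitone (hd : ∀ x, d x ≤ x) : Antitone (derivIter d a) := by
  intro β α
  induction α using Ordinal.limitRecOn with
  | zero => intro h; rw [nonpos_iff_eq_zero.1 h]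
  | add_one α ih =>
    intro h
    rcases h.eq_or_lt with rfl | h
    · rfl
    · rw [derivIter_add_one]
      exact (hd _).trans (ih (Order.lt_add_one_iff.1 h))
  | limit o ho ih =>
    intro h
    rcases h.eq_or_lt with rfl | h
    · rfl
    · rw [derivIter_limit d a ho]
      exact iInf₂_le β h

end DerivIter

/-- A decreasing transfinite iteration through closed subsets of a second countable space
stabilizes at a countable stage. -/
lemma exists_derivIter_eq_of_isClosed {Y : Type*} [TopologicalSpace Y] [SecondCountableTopology Y]
    {d : Set Y → Set Y} {A : Set Y} (hd : ∀ s, d s ⊆ s) (hc : ∀ s, IsClosed s → IsClosed (d s))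
    (hA : IsClosed A) :
    ∃ α < (Cardinal.aleph 1).ord, d (derivIter d A α) = derivIter d A α := by
  have hclosed (α : Ordinal) : IsClosed (derivIter d A α) := by
    induction α using Ordinal.limitRecOn with
    | zero => rwa [derivIter_zero]
    | add_one α ih => rw [derivIter_add_one]; exact hc _ ih
    | limit o ho ih =>
      rw [derivIter_limit d A ho]
      exact isClosed_biInter ih
  by_contra! hne
  have key (α : Iio (Cardinal.aleph 1).ord) :
      ∃ U : TopologicalSpace.countableBasis Y,
        (U.1 ∩ derivIter d A α).Nonempty ∧ Disjoint U.1 (derivIter d A (α.1 + 1)) := by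
    obtain ⟨x, hx, hx'⟩ := Set.exists_of_ssubset ((hd _).ssubset_of_ne (hne α.1 α.2))
    obtain ⟨U, hU, hxU, hUs⟩ := (TopologicalSpace.isBasis_countableBasis Y).exists_subset_of_mem_open
      hx' (hc _ (hclosed α.1)).isOpen_compl
    refine ⟨⟨U, hU⟩, ⟨x, hxU, hx⟩, ?_⟩
    rw [derivIter_add_one]
    exact Set.disjoint_left.2 hUs
  choose U hU hdisj using key
  have hlt {α β : Iio (Cardinal.aleph 1).ord} (h : α < β) : U α ≠ U β := by
    intro he
    obtain ⟨x, hxU, hx⟩ := hU β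
    rw [← he] at hxU
    exact Set.disjoint_left.1 (hdisj α) hxU
      (derivIter_antitone d A hd (Order.add_one_le_of_lt h) hx)
  have hinj : Function.Injective U := by
    intro α β h
    rcases lt_trichotomy α β with hαβ | hαβ | hαβ
    · exact (hlt hαβ h).elim
    · exact hαβ
    · exact (hlt hαβ h.symm).elim
  have : Countable (TopologicalSpace.countableBasis Y) :=
    (TopologicalSpace.countable_countableBasis Y).to_subtype
  have hcount : Countable (Iio (Cardinal.aleph 1).ord) := hinj.countable
  rw [← Cardinal.mk_le_aleph0_iff, Cardinal.mk_Iio_ordinal] at hcount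
  simp at hcount

lemma dentDeriv_subset (ε : ℝ) (C : Set X) : dentDeriv ε C ⊆ C := sdiff_subset

lemma isClosed_dentDeriv (ε : ℝ) {C : Set X} (hC : IsClosed C) : IsClosed (dentDeriv ε C) :=
  hC.sdiff <| isOpen_iUnion fun f ↦ isOpen_iUnion fun _ ↦ isOpen_iUnion fun _ ↦
    isOpen_lt continuous_const f.continuous

/-- A point of `C` outside `d_ε^1(D)` lies in a small slice of `C` whenever `C ⊆ D`. -/
lemma exists_small_slice_of_notMem_dentDeriv {ε : ℝ} {C D : Set X} (hD : Bornology.IsBounded D)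
    (hCD : C ⊆ D) {x : X} (hx : x ∈ C) (hx' : x ∉ dentDeriv ε D) :
    ∃ (f : X →L[ℝ] ℝ) (a : ℝ), ({y | a < f y} ∩ C).Nonempty ∧
      Metric.diam ({y | a < f y} ∩ C) < ε := by
  simp only [dentDeriv, mem_sdiff, hCD hx, true_and, not_not, mem_iUnion] at hx'
  obtain ⟨f, a, hdiam, hxf⟩ := hx'
  exact ⟨f, a, ⟨x, hxf, hx⟩, (Metric.diam_mono (inter_subset_inter_right _ hCD)
    (hD.subset inter_subset_right)).trans_lt hdiam⟩

/-- If the iterated derivations of a bounded set `A` reach `∅`, then every nonempty subset of `A`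
has a small slice. -/
lemma exists_small_slice_of_derivIter_eq_empty {ε : ℝ} {A C : Set X}
    (hA : Bornology.IsBounded A) (hCA : C ⊆ A) (hC : C.Nonempty) {α : Ordinal}
    (hα : derivIter (dentDeriv ε) A α = ∅) :
    ∃ (f : X →L[ℝ] ℝ) (a : ℝ), ({y | a < f y} ∩ C).Nonempty ∧
      Metric.diam ({y | a < f y} ∩ C) < ε := by
  by_contra hno
  have hsub (β : Ordinal) : C ⊆ derivIter (dentDeriv ε) A β := by
    induction β using Ordinal.limitRecOn with
    | zero => rwa [derivIter_zero]
    | add_one β ih =>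
      rw [derivIter_add_one]
      intro x hx
      by_contra hx'
      refine hno (exists_small_slice_of_notMem_dentDeriv (hA.subset ?_) ih hx hx')
      have := derivIter_antitone (dentDeriv ε) A (dentDeriv_subset ε) (zero_le (a := β))
      rwa [derivIter_zero] at this
    | limit o ho ih =>
      rw [derivIter_limit _ _ ho]
      exact subset_iInter₂ ih
  exact hC.ne_empty (subset_empty_iff.1 (hα ▸ hsub α))

/-- For a separable Banach space `X`: every nonempty bounded subset of `X` is
dentable iff `D(X) < ω₁`, i.e. for every `ε > 0` there is a countable ordinal `α` with
`d_ε^α(B_X) = ∅`. -/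
theorem statement1 {X : Type*} [NormedAddCommGroup X] [NormedSpace ℝ X] [CompleteSpace X]
    [TopologicalSpace.SeparableSpace X] :
    (∀ C : Set X, C.Nonempty → Bornology.IsBounded C → ∀ ε > (0 : ℝ),
        ∃ (f : X →L[ℝ] ℝ) (a : ℝ), ({y | a < f y} ∩ C).Nonempty ∧
          Metric.diam ({y | a < f y} ∩ C) < ε) ↔
      (∀ ε > (0 : ℝ), ∃ α < (Cardinal.aleph 1).ord,
        derivIter (dentDeriv ε) (Metric.closedBall (0 : X) 1) α = ∅) := by
  constructor
  · intro h ε hε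
    have : SecondCountableTopology X := UniformSpace.secondCountable_of_separable X
    obtain ⟨α, hα, heq⟩ := exists_derivIter_eq_of_isClosed (dentDeriv_subset ε)
      (fun _ ↦ isClosed_dentDeriv ε) (isClosed_closedBall (x := (0 : X)) (ε := 1))
    refine ⟨α, hα, not_nonempty_iff_eq_empty.1 fun hne ↦ ?_⟩
    have hsub := derivIter_antitone (dentDeriv ε) (closedBall (0 : X) 1) (dentDeriv_subset ε)
      (zero_le (a := α))
    rw [derivIter_zero] at hsub
    obtain ⟨f, a, ⟨x, hxf, hx⟩, hdiam⟩ := h _ hne (isBounded_closedBall.subset hsub) ε hε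
    rw [← heq] at hx
    exact hx.2 (mem_iUnion.2 ⟨f, mem_iUnion.2 ⟨a, mem_iUnion.2 ⟨hdiam, hxf⟩⟩⟩)
  · intro h C hC hb ε hε
    obtain ⟨r, hr, hCr⟩ := hb.subset_closedBall_lt 0 0
    obtain ⟨α, -, hα⟩ := h (r⁻¹ * ε) (by positivity)
    have hsub : (fun x ↦ r⁻¹ • x) '' C ⊆ closedBall (0 : X) 1 := by
      rintro _ ⟨x, hx, rfl⟩
      have := mem_closedBall_zero_iff.1 (hCr hx)
      rw [mem_closedBall_zero_iff, norm_smul, norm_inv, Real.norm_of_nonneg hr.le,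
        inv_mul_le_iff₀ hr, mul_one]
      exact this
    obtain ⟨f, a, ⟨_, hxf, x, hx, rfl⟩, hdiam⟩ :=
      exists_small_slice_of_derivIter_eq_empty isBounded_closedBall hsub (hC.image _) hα
    refine ⟨r⁻¹ • f, a, ⟨x, by simpa using hxf, hx⟩, ?_⟩
    open scoped Pointwise in
    have himage : {y | a < f y} ∩ (fun x ↦ r⁻¹ • x) '' C =
        r⁻¹ • ({y | a < (r⁻¹ • f) y} ∩ C) := by
      ext y
      simp only [mem_inter_iff, mem_ofPred_eq, mem_image, mem_smul_set]
      constructor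
      · rintro ⟨hy, x, hx, rfl⟩
        exact ⟨x, ⟨by simpa using hy, hx⟩, rfl⟩
      · rintro ⟨x, ⟨hy, hx⟩, rfl⟩
        exact ⟨by simpa using hy, x, hx, rfl⟩
    rw [himage, diam_smul₀, Real.norm_of_nonneg (by positivity)] at hdiam
    exact lt_of_mul_lt_mul_left hdiam (by positivity)
end
end

section
/- Let X be a Banach space and let T be a nonempty closed A-tree on X such that T ∩ X^{A_n} equals the closure of π_n(T ∩ X^{A_{n+1}}) for all n ∈ ω. Then T is ill-founded. -/
open Metric Set Topology

noncomputable section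

variable {X : Type*} [NormedAddCommGroup X] [NormedSpace ℝ X]

/-- An element of `closure (p '' S)` is approximated by `p f`, `f ∈ S`, uniformly on any finite set
of coordinates. -/
theorem exists_mem_forall_dist_lt_of_mem_closure_image {α β Y : Type*} [PseudoMetricSpace Y]
    {p : β → α → Y} {S : Set β} {f : α → Y} (hf : f ∈ closure (p '' S))
    {s : Set α} (hs : s.Finite) {ε : ℝ} (hε : 0 < ε) :
    ∃ f' ∈ S, ∀ a ∈ s, dist (p f' a) (f a) < ε := by
  have hnhds : {h : α → Y | ∀ a ∈ s, dist (h a) (f a) < ε} ∈ 𝓝 f :=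
    (Filter.eventually_all_finite hs).2 fun a _ =>
      (continuous_apply a).continuousAt.eventually (Metric.ball_mem_nhds (f a) hε)
  obtain ⟨_, hh, f', hf', rfl⟩ := mem_closure_iff_nhds.1 hf _ hnhds
  exact ⟨f', hf', hh⟩

/-- In a complete space, a sequence whose steps are eventually at most `(1 / 2) ^ n` converges. -/
theorem exists_tendsto_of_eventually_dist_le_geometric {Y : Type*} [PseudoMetricSpace Y]
    [CompleteSpace Y] {u : ℕ → Y}
    (hu : ∀ᶠ n in Filter.atTop, dist (u n) (u (n + 1)) ≤ (1 / 2 : ℝ) ^ n) :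
    ∃ y, Filter.Tendsto u Filter.atTop (𝓝 y) := by
  obtain ⟨N, hN⟩ := Filter.eventually_atTop.1 hu
  have hc : CauchySeq fun k => u (k + N) := by
    refine cauchySeq_of_le_geometric (1 / 2) 1 (by norm_num) fun k => ?_
    have h := hN (k + N) (by omega)
    rw [show k + N + 1 = k + 1 + N by omega] at h
    rw [one_mul]
    exact h.trans (pow_le_pow_of_le_one (by norm_num) (by norm_num) (by omega))
  obtain ⟨y, hy⟩ := cauchySeq_tendsto_of_complete hc
  exact ⟨y, (Filter.tendsto_add_atTop_iff_nat N).1 hy⟩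

/-- Let `T` be a nonempty closed `A`-tree on a Banach space `X` (here an
`A`-tree is given by its levels `T n ⊆ X^{A_n}`) such that for every `n`, `T ∩ X^{A_n}` is
the closure of `π_n(T ∩ X^{A_{n+1}})`. Then `T` is ill-founded. -/
theorem statement7 {X : Type*} [NormedAddCommGroup X] [NormedSpace ℝ X] [CompleteSpace X]
    {ι : Type*} (A : ℕ → Set ι)
    (hmono : ∀ n, A n ⊆ A (n + 1)) (hstrict : ∀ n, A n ≠ A (n + 1))
    (hcount : ∀ n, (A n).Countable) (h0 : (A 0).Nonempty) (hcover : ∀ x, ∃ n, x ∈ A n)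
    (T : ∀ n, Set (↥(A n) → X))
    (htree : ∀ n, ∀ f ∈ T (n + 1), (fun a : ↥(A n) => f (Set.inclusion (hmono n) a)) ∈ T n)
    (hclosed : ∀ n, IsClosed (T n))
    (hne : ∃ n, (T n).Nonempty)
    (hproj : ∀ n, T n = closure
      ((fun (f : ↥(A (n + 1)) → X) (a : ↥(A n)) => f (Set.inclusion (hmono n) a)) '' T (n + 1))) :
    ∃ g : ι → X, ∀ n, (fun a : ↥(A n) => g a.1) ∈ T n := by
  classical
  have hA : Monotone A := monotone_nat_of_le_succ hmono
  have : Countable ι := by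
    rw [← Set.countable_univ_iff, ← Set.iUnion_eq_univ_iff.2 hcover]
    exact Set.countable_iUnion hcount
  obtain ⟨e, he⟩ := exists_injective_nat ι
  let S : ℕ → Set (ι → X) := fun n => {F | (fun a : ↥(A n) => F a.1) ∈ T n}
  have hS : Antitone S := antitone_nat_of_succ_le fun n F hF => htree n _ hF
  have hext : ∀ n, ∀ f ∈ T n, ∃ F ∈ S n, ∀ a : ↥(A n), F a.1 = f a := by
    intro n f hf
    have hF : ∀ a : ↥(A n), (if h : a.1 ∈ A n then f ⟨a.1, h⟩ else 0) = f a := fun a => by simp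
    refine ⟨fun a => if h : a ∈ A n then f ⟨a, h⟩ else 0, ?_, hF⟩
    rwa [← funext hF] at hf
  have hstep : ∀ n, ∀ F ∈ S n, ∃ F' ∈ S (n + 1),
      ∀ a ∈ A n, e a ≤ n → dist (F a) (F' a) ≤ (1 / 2 : ℝ) ^ n := by
    intro n F hF
    have hcl : (fun a : ↥(A n) => F a.1) ∈ closure
        ((fun (f : ↥(A (n + 1)) → X) (a : ↥(A n)) => f (Set.inclusion (hmono n) a)) ''
          T (n + 1)) := hproj n ▸ hF
    have hfin : {a : ↥(A n) | e a.1 ≤ n}.Finite :=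
      (Set.finite_Iic n).preimage (he.comp Subtype.val_injective).injOn
    obtain ⟨f', hf', hd⟩ := exists_mem_forall_dist_lt_of_mem_closure_image hcl hfin
      (by positivity : (0 : ℝ) < (1 / 2) ^ n)
    obtain ⟨F', hF', hF'f⟩ := hext (n + 1) f' hf'
    refine ⟨F', hF', fun a ha hea => ?_⟩
    rw [dist_comm, hF'f ⟨a, hmono n ha⟩]
    exact (hd ⟨a, ha⟩ hea).le
  obtain ⟨F₀, hF₀⟩ : (S 0).Nonempty := by
    obtain ⟨n, f, hf⟩ := hne
    obtain ⟨F, hF, -⟩ := hext n f hf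
    exact ⟨F, hS (Nat.zero_le n) hF⟩
  choose next hnext hdist using hstep
  let seq : ∀ n, S n := fun n =>
    Nat.rec ⟨F₀, hF₀⟩ (fun k F => ⟨next k F.1 F.2, hnext k F.1 F.2⟩) n
  have hlim : ∀ a, ∃ y, Filter.Tendsto (fun n => (seq n).1 a) Filter.atTop (𝓝 y) := by
    intro a
    obtain ⟨m, hm⟩ := hcover a
    refine exists_tendsto_of_eventually_dist_le_geometric ?_
    filter_upwards [Filter.eventually_ge_atTop m, Filter.eventually_ge_atTop (e a)] with n hn hn'
    exact hdist n (seq n).1 (seq n).2 a (hA hn hm) hn'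
  choose g hg using hlim
  refine ⟨g, fun m => (hclosed m).mem_of_tendsto (tendsto_pi_nhds.2 fun a => hg a.1) ?_⟩
  filter_upwards [Filter.eventually_ge_atTop m] with n hn
  exact hS hn (seq n).2
end
end

section
/- Let X be a separable Banach space. Then X fails the Infinite Tree Property if and only if DT(X) < ω₁, i.e., for every δ > 0 there exists a countable ordinal α such that B_X contains no δ-α-tree. -/
open Metric Set Topology

noncomputable section

variable {X : Type*} [NormedAddCommGroup X] [NormedSpace ℝ X]

/-- `X` has the Infinite Tree Property: for some `δ > 0` there is a family in `B_X` indexed by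
all finite `0-1` sequences with `x_s = ½(x_{s⌢0} + x_{s⌢1})` and `½‖x_{s⌢0} - x_{s⌢1}‖ ≥ δ`. -/
def InfiniteTreeProperty (X : Type*) [NormedAddCommGroup X] [NormedSpace ℝ X] : Prop :=
  ∃ δ > (0 : ℝ), ∃ x : List Bool → X, (∀ s, ‖x s‖ ≤ 1) ∧
    ∀ s : List Bool,
      x s = (2⁻¹ : ℝ) • (x (s ++ [false]) + x (s ++ [true])) ∧
      δ ≤ 2⁻¹ * ‖x (s ++ [false]) - x (s ++ [true])‖

/-! ### Basic properties of `treeRoot` -/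

theorem treeRoot_zero (C : Set X) (δ : ℝ) (x : X) : treeRoot C δ 0 x ↔ x ∈ C := by
  simp [treeRoot]

theorem treeRoot_add_one (C : Set X) (δ : ℝ) (α : Ordinal) (x : X) :
    treeRoot C δ (α + 1) x ↔ x ∈ C ∧ ∃ y z : X,
      x = (2⁻¹ : ℝ) • (y + z) ∧ δ ≤ 2⁻¹ * ‖y - z‖ ∧ treeRoot C δ α y ∧ treeRoot C δ α z := by
  simp [treeRoot]

theorem treeRoot_limit (C : Set X) (δ : ℝ) {α : Ordinal} (hα : Order.IsSuccLimit α) (x : X) :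
    treeRoot C δ α x ↔ ∀ γ < α, treeRoot C δ γ x := by
  simp [treeRoot, Ordinal.limitRecOn_limit _ _ _ _ hα]

theorem treeRoot.mem {C : Set X} {δ : ℝ} {α : Ordinal} {x : X} (h : treeRoot C δ α x) :
    x ∈ C := by
  induction α using Ordinal.limitRecOn with
  | zero => exact (treeRoot_zero C δ x).1 h
  | add_one α _ => exact ((treeRoot_add_one C δ α x).1 h).1
  | limit α hα ih =>
    have h0 : 0 < α := hα.bot_lt
    exact ih 0 h0 ((treeRoot_limit C δ hα x).1 h 0 h0)

theorem treeRoot.of_add_one {C : Set X} {δ : ℝ} {α : Ordinal} {x : X}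
    (h : treeRoot C δ (α + 1) x) : treeRoot C δ α x := by
  induction α using Ordinal.limitRecOn generalizing x with
  | zero => exact (treeRoot_zero C δ x).2 h.mem
  | add_one α ih =>
    obtain ⟨hx, y, z, hxyz, hδ, hy, hz⟩ := (treeRoot_add_one C δ _ x).1 h
    exact (treeRoot_add_one C δ α x).2 ⟨hx, y, z, hxyz, hδ, ih hy, ih hz⟩
  | limit α hα ih =>
    obtain ⟨hx, y, z, hxyz, hδ, hy, hz⟩ := (treeRoot_add_one C δ _ x).1 h
    rw [treeRoot_limit C δ hα] at hy hz ⊢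
    exact fun γ hγ => ih γ hγ <|
      (treeRoot_add_one C δ γ x).2 ⟨hx, y, z, hxyz, hδ, hy γ hγ, hz γ hγ⟩

theorem treeRoot.mono {C : Set X} {δ : ℝ} {α β : Ordinal} (hαβ : α ≤ β) {x : X}
    (h : treeRoot C δ β x) : treeRoot C δ α x := by
  induction β using Ordinal.limitRecOn with
  | zero => rwa [nonpos_iff_eq_zero.1 hαβ]
  | add_one β ih =>
    rcases hαβ.eq_or_lt with rfl | hlt
    · exact h
    · exact ih (Order.lt_add_one_iff.1 hlt) h.of_add_one
  | limit β hβ _ =>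
    rcases hαβ.eq_or_lt with rfl | hlt
    · exact h
    · exact (treeRoot_limit C δ hβ x).1 h α hlt

/-- Every node of an infinite `δ`-tree in `C` is the root of a `δ`-`α`-tree in `C`, for all `α`. -/
theorem treeRoot_of_infinite_tree {C : Set X} {δ : ℝ} {x : List Bool → X} (hC : ∀ s, x s ∈ C)
    (hx : ∀ s, x s = (2⁻¹ : ℝ) • (x (s ++ [false]) + x (s ++ [true])) ∧
      δ ≤ 2⁻¹ * ‖x (s ++ [false]) - x (s ++ [true])‖) (α : Ordinal) (s : List Bool) :
    treeRoot C δ α (x s) := by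
  induction α using Ordinal.limitRecOn generalizing s with
  | zero => exact (treeRoot_zero C δ _).2 (hC s)
  | add_one α ih =>
    exact (treeRoot_add_one C δ α _).2 ⟨hC s, _, _, (hx s).1, (hx s).2, ih _, ih _⟩
  | limit α hα ih => exact (treeRoot_limit C δ hα _).2 fun γ hγ => ih γ hγ s

/-! ### A pigeonhole principle -/

/-- A decreasing `ω₁`-sequence of nonempty subsets of a countable type has a common point. -/
theorem exists_forall_lt_omega_one {ι : Type*} [Countable ι] {P : Ordinal → ι → Prop}
    (hmono : ∀ i α β, α ≤ β → P β i → P α i)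
    (hex : ∀ α < (Cardinal.aleph 1).ord, ∃ i, P α i) :
    ∃ i, ∀ α < (Cardinal.aleph 1).ord, P α i := by
  by_contra! h
  choose f hf hP using h
  have hsup : ⨆ i, f i < (Cardinal.aleph 1).ord := by
    rw [Cardinal.ord_aleph] at hf ⊢
    exact Ordinal.iSup_lt_omega_one hf
  obtain ⟨i, hi⟩ := hex _ hsup
  exact hP i (hmono i _ _ (Ordinal.le_iSup f i) hi)

/-! ### From approximate trees to trees -/

/-- The average of `e` over the `m`-th level of the binary tree above `t`, where the successors
of `t` are `false :: t` and `true :: t`. -/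
def levelAverage (e : List Bool → X) : ℕ → List Bool → X
  | 0, t => e t
  | m + 1, t => (2⁻¹ : ℝ) • (levelAverage e m (false :: t) + levelAverage e m (true :: t))

theorem norm_half_smul_add_le {a b : X} {r : ℝ} (ha : ‖a‖ ≤ r) (hb : ‖b‖ ≤ r) :
    ‖(2⁻¹ : ℝ) • (a + b)‖ ≤ r := by
  rw [norm_smul, Real.norm_of_nonneg (by norm_num)]
  linarith [norm_add_le a b]

theorem norm_levelAverage_le {e : List Bool → X} {c : ℝ}
    (he : ∀ t, ‖e t‖ ≤ 1 + c * 2⁻¹ ^ t.length) (m : ℕ) (t : List Bool) :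
    ‖levelAverage e m t‖ ≤ 1 + c * 2⁻¹ ^ t.length * 2⁻¹ ^ m := by
  induction m generalizing t with
  | zero => simpa [levelAverage] using he t
  | succ m ih =>
    have key : ∀ b, ‖levelAverage e m (b :: t)‖ ≤ 1 + c * 2⁻¹ ^ t.length * 2⁻¹ ^ (m + 1) :=
      fun b => (ih (b :: t)).trans_eq (by rw [List.length_cons]; ring)
    exact norm_half_smul_add_le (key _) (key _)

theorem dist_levelAverage_succ_le {e : List Bool → X} {c : ℝ}
    (he : ∀ t, ‖e t - (2⁻¹ : ℝ) • (e (false :: t) + e (true :: t))‖ ≤ c * 2⁻¹ ^ t.length)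
    (m : ℕ) (t : List Bool) :
    dist (levelAverage e m t) (levelAverage e (m + 1) t) ≤ c * 2⁻¹ ^ t.length * 2⁻¹ ^ m := by
  induction m generalizing t with
  | zero => simpa [levelAverage, dist_eq_norm] using he t
  | succ m ih =>
    have key : ∀ b, ‖levelAverage e m (b :: t) - levelAverage e (m + 1) (b :: t)‖
        ≤ c * 2⁻¹ ^ t.length * 2⁻¹ ^ (m + 1) := fun b => by
      rw [← dist_eq_norm]
      exact (ih (b :: t)).trans_eq (by rw [List.length_cons]; ring)
    have hsplit : levelAverage e (m + 1) t - levelAverage e (m + 1 + 1) t = (2⁻¹ : ℝ) •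
        ((levelAverage e m (false :: t) - levelAverage e (m + 1) (false :: t)) +
          (levelAverage e m (true :: t) - levelAverage e (m + 1) (true :: t))) := by
      rw [levelAverage, levelAverage]
      module
    rw [dist_eq_norm, hsplit]
    exact norm_half_smul_add_le (key _) (key _)

/-- An approximate tree with summable defects can be corrected to an infinite tree. -/
theorem infiniteTreeProperty_of_approximate [CompleteSpace X] {e : List Bool → X} {c δ : ℝ}
    (hc : 0 ≤ c) (hδ : 2 * c < δ) (hball : ∀ t, ‖e t‖ ≤ 1 + c * 2⁻¹ ^ t.length)
    (hmid : ∀ t, ‖e t - (2⁻¹ : ℝ) • (e (false :: t) + e (true :: t))‖ ≤ c * 2⁻¹ ^ t.length)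
    (hsep : ∀ t, δ ≤ 2⁻¹ * ‖e (false :: t) - e (true :: t)‖) :
    InfiniteTreeProperty X := by
  have hr : (2⁻¹ : ℝ) < 1 := by norm_num
  have hcauchy : ∀ t, CauchySeq fun m => levelAverage e m t := fun t =>
    cauchySeq_of_le_geometric 2⁻¹ _ hr fun m => dist_levelAverage_succ_le hmid m t
  choose x hx using fun t => cauchySeq_tendsto_of_complete (hcauchy t)
  have hdist : ∀ t, ‖e t - x t‖ ≤ 2 * c := fun t => by
    have h := dist_le_of_le_geometric_of_tendsto₀ 2⁻¹ _ hr
      (fun m => dist_levelAverage_succ_le hmid m t) (hx t)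
    rw [dist_eq_norm] at h
    have hp : (2⁻¹ : ℝ) ^ t.length ≤ 1 := pow_le_one₀ (by norm_num) hr.le
    have hcp := mul_le_of_le_one_right hc hp
    calc ‖e t - x t‖ ≤ c * 2⁻¹ ^ t.length / (1 - 2⁻¹) := h
      _ = 2 * (c * 2⁻¹ ^ t.length) := by ring
      _ ≤ 2 * c := by linarith
  have hxball : ∀ t, ‖x t‖ ≤ 1 := fun t => by
    have hlim : Filter.Tendsto (fun m : ℕ => 1 + c * 2⁻¹ ^ t.length * (2⁻¹ : ℝ) ^ m)
        Filter.atTop (𝓝 (1 + c * 2⁻¹ ^ t.length * 0)) :=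
      ((tendsto_pow_atTop_nhds_zero_of_lt_one (by norm_num) hr).const_mul _).const_add _
    simpa using le_of_tendsto_of_tendsto' (hx t).norm hlim
      fun m => norm_levelAverage_le hball m t
  have hxmid : ∀ t, x t = (2⁻¹ : ℝ) • (x (false :: t) + x (true :: t)) := fun t =>
    tendsto_nhds_unique ((hx t).comp (Filter.tendsto_add_atTop_nat 1))
      (((hx (false :: t)).add (hx (true :: t))).const_smul (2⁻¹ : ℝ))
  refine ⟨δ - 2 * c, by linarith, fun s => x s.reverse, fun s => hxball _, fun s => ?_⟩
  simp only [List.reverse_append, List.reverse_singleton, List.singleton_append]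
  refine ⟨hxmid _, ?_⟩
  set t := s.reverse
  have h1 : ‖e (false :: t) - e (true :: t)‖ ≤ ‖x (false :: t) - x (true :: t)‖
      + ‖e (false :: t) - x (false :: t)‖ + ‖e (true :: t) - x (true :: t)‖ := by
    have heq : e (false :: t) - e (true :: t) = (x (false :: t) - x (true :: t))
      + (e (false :: t) - x (false :: t)) - (e (true :: t) - x (true :: t)) := by abel
    rw [heq]
    exact (norm_sub_le _ _).trans (by gcongr; exact norm_add_le _ _)
  linarith [hsep t, hdist (false :: t), hdist (true :: t)]

/-! ### Points close to roots of trees of every countable height -/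

/-- For every countable `α`, there is a root of a `δ`-`α`-tree in the unit ball within `ε`
of `d`. -/
def NearTreeRoots.{u, v} {X : Type u} [NormedAddCommGroup X] [NormedSpace ℝ X]
    (δ ε : ℝ) (d : X) : Prop :=
  ∀ α < (Cardinal.aleph.{v} 1).ord, ∃ u : X,
    treeRoot (Metric.closedBall (0 : X) 1) δ α u ∧ ‖d - u‖ ≤ ε

universe v

theorem exists_nearTreeRoots [TopologicalSpace.SeparableSpace X] {δ ε : ℝ} (hε : 0 < ε)
    (h : ∀ α < (Cardinal.aleph.{v} 1).ord,
      ∃ x : X, treeRoot (Metric.closedBall (0 : X) 1) δ α x) :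
    ∃ d : X, NearTreeRoots.{_, v} δ ε d := by
  obtain ⟨i, hi⟩ := exists_forall_lt_omega_one
    (P := fun α i => ∃ u : X, treeRoot (Metric.closedBall (0 : X) 1) δ α u ∧
      ‖TopologicalSpace.denseSeq X i - u‖ ≤ ε)
    (fun i α β hαβ ⟨u, hu, hd⟩ => ⟨u, hu.mono hαβ, hd⟩) fun α hα => by
      obtain ⟨x, hx⟩ := h α hα
      obtain ⟨i, hi⟩ := (TopologicalSpace.denseRange_denseSeq X).exists_dist_lt x hε
      rw [dist_comm, dist_eq_norm] at hi
      exact ⟨i, x, hx, hi.le⟩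
  exact ⟨_, hi⟩

theorem NearTreeRoots.exists_children [TopologicalSpace.SeparableSpace X] {δ ε ε' : ℝ} {d : X}
    (hε' : 0 < ε') (hd : NearTreeRoots.{_, v} δ ε d) :
    ∃ y z : X, NearTreeRoots.{_, v} δ ε' y ∧ NearTreeRoots.{_, v} δ ε' z ∧
      ‖d - (2⁻¹ : ℝ) • (y + z)‖ ≤ ε + ε' ∧ δ - ε' ≤ 2⁻¹ * ‖y - z‖ := by
  set D := TopologicalSpace.denseSeq X
  obtain ⟨p, hp⟩ := exists_forall_lt_omega_one (ι := ℕ × ℕ)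
    (P := fun α p =>
      ((∃ u : X, treeRoot (Metric.closedBall (0 : X) 1) δ α u ∧ ‖D p.1 - u‖ ≤ ε') ∧
        ∃ v : X, treeRoot (Metric.closedBall (0 : X) 1) δ α v ∧ ‖D p.2 - v‖ ≤ ε') ∧
      ‖d - (2⁻¹ : ℝ) • (D p.1 + D p.2)‖ ≤ ε + ε' ∧ δ - ε' ≤ 2⁻¹ * ‖D p.1 - D p.2‖)
    (fun p α β hαβ ⟨⟨⟨u, hu, hu'⟩, v, hv, hv'⟩, hR⟩ =>
      ⟨⟨⟨u, hu.mono hαβ, hu'⟩, v, hv.mono hαβ, hv'⟩, hR⟩) fun α hα => by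
      have hα1 : α + 1 < (Cardinal.aleph 1).ord :=
        (Cardinal.isSuccLimit_ord (Cardinal.aleph0_le_aleph 1)).add_one_lt hα
      obtain ⟨x, hx, hdx⟩ := hd _ hα1
      obtain ⟨-, u, v, rfl, hδ, hu, hv⟩ := (treeRoot_add_one _ δ α x).1 hx
      obtain ⟨i, hi⟩ := (TopologicalSpace.denseRange_denseSeq X).exists_dist_lt u hε'
      obtain ⟨j, hj⟩ := (TopologicalSpace.denseRange_denseSeq X).exists_dist_lt v hε'
      rw [dist_comm, dist_eq_norm] at hi hj
      refine ⟨(i, j), ⟨⟨u, hu, hi.le⟩, v, hv, hj.le⟩, ?_, ?_⟩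
      · have heq : d - (2⁻¹ : ℝ) • (D i + D j) = (d - (2⁻¹ : ℝ) • (u + v))
            - (2⁻¹ : ℝ) • ((D i - u) + (D j - v)) := by module
        rw [heq]
        exact (norm_sub_le _ _).trans (add_le_add hdx (norm_half_smul_add_le hi.le hj.le))
      · have heq : u - v = (D i - D j) - (D i - u) + (D j - v) := by abel
        have h1 := norm_add_le ((D i - D j) - (D i - u)) (D j - v)
        have h2 := norm_sub_le (D i - D j) (D i - u)
        rw [← heq] at h1
        linarith
  have hpos : (0 : Ordinal) < (Cardinal.aleph 1).ord :=
    (Cardinal.isSuccLimit_ord (Cardinal.aleph0_le_aleph 1)).bot_lt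
  exact ⟨D p.1, D p.2, fun α hα => (hp α hα).1.1, fun α hα => (hp α hα).1.2, (hp 0 hpos).2⟩

theorem NearTreeRoots.norm_le {δ ε : ℝ} {d : X} (hd : NearTreeRoots.{_, v} δ ε d) : ‖d‖ ≤ 1 + ε := by
  obtain ⟨u, hu, hdu⟩ :=
    hd 0 (Cardinal.isSuccLimit_ord (Cardinal.aleph0_le_aleph 1)).bot_lt
  have hu1 := mem_closedBall_zero_iff.1 hu.mem
  linarith [norm_le_norm_add_norm_sub' d u]

theorem infiniteTreeProperty_of_treeRoot [CompleteSpace X] [TopologicalSpace.SeparableSpace X]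
    {δ : ℝ} (hδ : 0 < δ)
    (h : ∀ α < (Cardinal.aleph.{v} 1).ord,
      ∃ x : X, treeRoot (Metric.closedBall (0 : X) 1) δ α x) :
    InfiniteTreeProperty X := by
  set c := δ / 10 with hc
  have hε : ∀ n : ℕ, 0 < c * (2⁻¹ : ℝ) ^ n := fun n => by positivity
  obtain ⟨d₀, hd₀⟩ := exists_nearTreeRoots (hε 0) h
  choose y z hy hz hmid hsep using
    fun (n : ℕ) (d : {d : X // NearTreeRoots.{_, v} δ (c * (2⁻¹ : ℝ) ^ n) d}) =>
      d.2.exists_children (hε (n + 1))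
  let e : (t : List Bool) → {d : X // NearTreeRoots.{_, v} δ (c * (2⁻¹ : ℝ) ^ t.length) d} := fun t =>
    List.rec ⟨d₀, hd₀⟩ (fun b t d => bif b then ⟨z _ d, hz _ d⟩ else ⟨y _ d, hy _ d⟩) t
  have hpow : ∀ n : ℕ, (2⁻¹ : ℝ) ^ n ≤ 1 := fun n => pow_le_one₀ (by norm_num) (by norm_num)
  refine infiniteTreeProperty_of_approximate (e := fun t => (e t).1) (c := 2 * c)
    (δ := δ - c) (by positivity) (by linarith) (fun t => ?_) (fun t => ?_) (fun t => ?_)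
  · exact (e t).2.norm_le.trans (by linarith [hε t.length])
  · refine (hmid _ (e t)).trans ?_
    rw [pow_succ]
    linarith [hε t.length]
  · refine le_trans ?_ (hsep _ (e t))
    have := mul_le_of_le_one_right (by positivity : 0 ≤ c) (hpow (t.length + 1))
    linarith

/-- A separable Banach space `X` fails the Infinite Tree Property iff
`DT(X) < ω₁`: for every `δ > 0` there is a countable ordinal `α` such that `B_X` contains no
`δ`-`α`-tree. -/
theorem statement10 {X : Type*} [NormedAddCommGroup X] [NormedSpace ℝ X] [CompleteSpace X]
    [TopologicalSpace.SeparableSpace X] :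
    ¬ InfiniteTreeProperty X ↔
      ∀ δ > (0 : ℝ), ∃ α < (Cardinal.aleph 1).ord,
        ¬ ∃ x : X, treeRoot (Metric.closedBall (0 : X) 1) δ α x := by
  constructor
  · intro h δ hδ
    by_contra! hcon
    exact h (infiniteTreeProperty_of_treeRoot hδ hcon)
  · rintro h ⟨δ, hδ, x, hx, hxs⟩
    obtain ⟨α, -, hα⟩ := h δ hδ
    exact hα ⟨x [], treeRoot_of_infinite_tree (fun s => by simpa using hx s) hxs α []⟩
end
end

section
/- Let X be a separable Banach space. Then X fails the Infinite Sprawling Tree Property if and only if ST(X) < ω₁, i.e., for every δ > 0 there exists a countable ordinal α such that B_X contains no δ-α-sprawling tree. -/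
open Metric Set Topology

noncomputable section

variable {X : Type*} [NormedAddCommGroup X] [NormedSpace ℝ X]

/-- `X` has the Infinite Sprawling Tree Property: for some `δ > 0` there is a family in `B_X`
indexed by all finite sequences in `{0,1} × ω` with `x_s = ½(x_{s⌢(0,n)} + x_{s⌢(1,n)})` for
every `n` and `‖x_{s⌢(0,n)} - x_{s⌢(0,m)}‖ ≥ δ` for `n ≠ m`. -/
def InfiniteSprawlingTreeProperty (X : Type*) [NormedAddCommGroup X] [NormedSpace ℝ X] : Prop :=
  ∃ δ > (0 : ℝ), ∃ x : List (Bool × ℕ) → X, (∀ s, ‖x s‖ ≤ 1) ∧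
    ∀ s : List (Bool × ℕ),
      (∀ n : ℕ, x s = (2⁻¹ : ℝ) • (x (s ++ [(false, n)]) + x (s ++ [(true, n)]))) ∧
      (∀ n m : ℕ, n ≠ m → δ ≤ ‖x (s ++ [(false, n)]) - x (s ++ [(false, m)])‖)

@[simp]
theorem sprawlRoot_zero {C : Set X} {δ : ℝ} {x : X} : sprawlRoot C δ 0 x ↔ x ∈ C := by
  simp [sprawlRoot]

theorem sprawlRoot_add_one {C : Set X} {δ : ℝ} {α : Ordinal} {x : X} :
    sprawlRoot C δ (α + 1) x ↔ x ∈ C ∧ ∃ y z : ℕ → X,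
      (∀ n, x = (2⁻¹ : ℝ) • (y n + z n)) ∧ (∀ n m, n ≠ m → δ ≤ ‖y n - y m‖) ∧
      (∀ n, sprawlRoot C δ α (y n)) ∧ (∀ n, sprawlRoot C δ α (z n)) := by
  simp only [sprawlRoot, Ordinal.limitRecOn_add_one]

theorem sprawlRoot_limit {C : Set X} {δ : ℝ} {o : Ordinal} (ho : Order.IsSuccLimit o) {x : X} :
    sprawlRoot C δ o x ↔ ∀ γ < o, sprawlRoot C δ γ x := by
  simp only [sprawlRoot, Ordinal.limitRecOn_limit _ _ _ _ ho]

theorem sprawlRoot_of_add_one {C : Set X} {δ : ℝ} (α : Ordinal) :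
    ∀ x : X, sprawlRoot C δ (α + 1) x → sprawlRoot C δ α x := by
  induction α using Ordinal.limitRecOn with
  | zero => exact fun x h => sprawlRoot_zero.2 (sprawlRoot_add_one.1 h).1
  | add_one α ih =>
    intro x h
    obtain ⟨hx, y, z, hyz, hδ, hy, hz⟩ := sprawlRoot_add_one.1 h
    exact sprawlRoot_add_one.2
      ⟨hx, y, z, hyz, hδ, fun n => ih _ (hy n), fun n => ih _ (hz n)⟩
  | limit o ho ih =>
    intro x h
    obtain ⟨hx, y, z, hyz, hδ, hy, hz⟩ := sprawlRoot_add_one.1 h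
    refine (sprawlRoot_limit ho).2 fun γ hγ => ih γ hγ x ?_
    exact sprawlRoot_add_one.2 ⟨hx, y, z, hyz, hδ,
      fun n => (sprawlRoot_limit ho).1 (hy n) γ hγ, fun n => (sprawlRoot_limit ho).1 (hz n) γ hγ⟩

theorem sprawlRoot_anti {C : Set X} {δ : ℝ} {α β : Ordinal} (hαβ : α ≤ β) {x : X}
    (h : sprawlRoot C δ β x) : sprawlRoot C δ α x := by
  induction β using Ordinal.limitRecOn with
  | zero => rwa [nonpos_iff_eq_zero.1 hαβ]
  | add_one β ih =>
    rcases hαβ.eq_or_lt with rfl | hlt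
    · exact h
    · exact ih (Order.lt_add_one_iff.1 hlt) (sprawlRoot_of_add_one β x h)
  | limit o ho ih =>
    rcases hαβ.eq_or_lt with rfl | hlt
    · exact h
    · exact (sprawlRoot_limit ho).1 h α hlt

theorem sprawlRoot_of_tree {C : Set X} {δ : ℝ} {x : List (Bool × ℕ) → X} (hC : ∀ s, x s ∈ C)
    (hx : ∀ s : List (Bool × ℕ),
      (∀ n : ℕ, x s = (2⁻¹ : ℝ) • (x (s ++ [(false, n)]) + x (s ++ [(true, n)]))) ∧
      (∀ n m : ℕ, n ≠ m → δ ≤ ‖x (s ++ [(false, n)]) - x (s ++ [(false, m)])‖))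
    (α : Ordinal) : ∀ s, sprawlRoot C δ α (x s) := by
  induction α using Ordinal.limitRecOn with
  | zero => exact fun s => sprawlRoot_zero.2 (hC s)
  | add_one α ih =>
    exact fun s => sprawlRoot_add_one.2
      ⟨hC s, _, _, (hx s).1, (hx s).2, fun _ => ih _, fun _ => ih _⟩
  | limit o ho ih => exact fun s => (sprawlRoot_limit ho).2 fun γ hγ => ih γ hγ s

/-- A decreasing family of sets indexed by the countable ordinals has closures that stabilize,
in any second countable space. -/
theorem exists_subset_closure_add_one {Y : Type*} [TopologicalSpace Y]
    [SecondCountableTopology Y] {K : Ordinal → Set Y} (hK : Antitone K) :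
    ∃ α < (Cardinal.aleph 1).ord, K α ⊆ closure (K (α + 1)) := by
  have hb := TopologicalSpace.isBasis_countableBasis Y
  have := (TopologicalSpace.countable_countableBasis Y).to_subtype
  let U : TopologicalSpace.countableBasis Y → Set Y := Subtype.val
  have hlim : Order.IsSuccLimit (Cardinal.aleph 1).ord :=
    Cardinal.isSuccLimit_ord (Cardinal.aleph0_le_aleph 1)
  have key : ∀ n, ∃ α < (Cardinal.aleph 1).ord,
      ∀ β < (Cardinal.aleph 1).ord, Disjoint (U n) (K β) → Disjoint (U n) (K α) := by
    intro n
    by_cases h : ∃ β < (Cardinal.aleph 1).ord, Disjoint (U n) (K β)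
    · obtain ⟨β, hβ, hd⟩ := h
      exact ⟨β, hβ, fun _ _ _ => hd⟩
    · exact ⟨0, hlim.bot_lt, fun β hβ hd => (h ⟨β, hβ, hd⟩).elim⟩
  choose a ha hd using key
  have hsup : ⨆ n, a n < (Cardinal.aleph 1).ord := by
    rw [Cardinal.ord_aleph] at ha ⊢
    exact Ordinal.iSup_lt_omega_one ha
  refine ⟨⨆ n, a n, hsup, fun x hx => hb.mem_closure_iff.2 ?_⟩
  intro V hV hxn
  by_contra hne
  have hdis := hd ⟨V, hV⟩ _ (hlim.add_one_lt hsup)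
    (Set.disjoint_iff_inter_eq_empty.2 (Set.not_nonempty_iff_eq_empty.1 hne))
  exact Set.disjoint_left.1 hdis hxn (hK (Ordinal.le_iSup a ⟨V, hV⟩) hx)

/-- If every point of a nonempty bounded set is the midpoint of infinitely many pairs from the
set with `δ`-separated first members, these pairs can be iterated to an infinite sprawling tree. -/
theorem InfiniteSprawlingTreeProperty.of_set {N : Set X} (hne : N.Nonempty) {R : ℝ} (hR : 0 < R)
    (hN : ∀ x ∈ N, ‖x‖ ≤ R) {δ : ℝ} (hδ : 0 < δ)
    (h : ∀ x ∈ N, ∃ y z : ℕ → X, (∀ n, x = (2⁻¹ : ℝ) • (y n + z n)) ∧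
      (∀ n m, n ≠ m → δ ≤ ‖y n - y m‖) ∧ (∀ n, y n ∈ N) ∧ (∀ n, z n ∈ N)) :
    InfiniteSprawlingTreeProperty X := by
  have h' : ∀ p : N, ∃ y z : ℕ → N, (∀ n, (p : X) = (2⁻¹ : ℝ) • ((y n : X) + z n)) ∧
      (∀ n m, n ≠ m → δ ≤ ‖(y n : X) - y m‖) := by
    rintro ⟨x, hx⟩
    obtain ⟨y, z, hyz, hd, hy, hz⟩ := h x hx
    exact ⟨fun n => ⟨y n, hy n⟩, fun n => ⟨z n, hz n⟩, hyz, hd⟩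
  choose y z hyz hd using h'
  obtain ⟨x₀, hx₀⟩ := hne
  let t : List (Bool × ℕ) → N :=
    List.foldl (fun p i => cond i.1 (z p i.2) (y p i.2)) ⟨x₀, hx₀⟩
  have ht : ∀ s i, t (s ++ [i]) = cond i.1 (z (t s) i.2) (y (t s) i.2) := by
    intro s i
    simp [t]
  refine ⟨R⁻¹ * δ, by positivity, fun s => R⁻¹ • (t s : X), fun s => ?_, fun s =>
    ⟨fun n => ?_, fun n m hnm => ?_⟩⟩
  · rw [norm_smul, Real.norm_of_nonneg (by positivity), inv_mul_le_one₀ hR]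
    exact hN _ (t s).2
  · simp only [ht, cond]
    rw [← smul_add, smul_comm, ← hyz]
  · simp only [ht, cond]
    rw [← smul_sub, norm_smul, Real.norm_of_nonneg (by positivity)]
    gcongr
    exact hd _ n m hnm

/-- Stabilization of the closures of the sets of roots turns arbitrarily tall countable sprawling
trees into an infinite one. -/
theorem InfiniteSprawlingTreeProperty.of_sprawlRoot [TopologicalSpace.SeparableSpace X] {δ : ℝ}
    (hδ : 0 < δ) (h : ∀ α < (Cardinal.aleph 1).ord,
      ∃ x : X, sprawlRoot (Metric.closedBall (0 : X) 1) δ α x) :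
    InfiniteSprawlingTreeProperty X := by
  have : SecondCountableTopology X := UniformSpace.secondCountable_of_separable X
  set C := Metric.closedBall (0 : X) 1
  obtain ⟨α, hα, hcl⟩ := exists_subset_closure_add_one
    (K := fun α => {x : X | sprawlRoot C δ α x}) fun _ _ hab _ hx => sprawlRoot_anti hab hx
  refine .of_set (N := {x | ∃ d, sprawlRoot C δ α d ∧ ‖x - d‖ < 1}) ?_ (R := 2) two_pos ?_ hδ ?_
  · obtain ⟨x, hx⟩ := h α hα
    exact ⟨x, x, hx, by simp⟩
  · rintro x ⟨d, hd, hxd⟩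
    have hdC : ‖d‖ ≤ 1 := mem_closedBall_zero_iff.1
      (sprawlRoot_zero.1 (sprawlRoot_anti zero_le hd))
    have := norm_add_le (x - d) d
    rw [sub_add_cancel] at this
    linarith
  · rintro x ⟨d, hd, hxd⟩
    obtain ⟨e, he, hde⟩ := Metric.mem_closure_iff.1 (hcl hd) (1 - ‖x - d‖) (by linarith)
    have hxe : ‖x - e‖ < 1 := by
      have := norm_sub_le_norm_sub_add_norm_sub x d e
      rw [dist_eq_norm] at hde
      linarith
    obtain ⟨-, y, z, hyz, hsep, hy, hz⟩ := sprawlRoot_add_one.1 he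
    refine ⟨fun n => y n + (x - e), fun n => z n + (x - e), fun n => ?_, fun n m hnm => ?_,
      fun n => ⟨y n, hy n, by simpa using hxe⟩, fun n => ⟨z n, hz n, by simpa using hxe⟩⟩
    · rw [add_add_add_comm, smul_add, ← hyz n, ← two_smul ℝ (x - e), inv_smul_smul₀ two_ne_zero,
        add_sub_cancel]
    · simpa using hsep n m hnm

/-- A separable Banach space `X` fails the Infinite Sprawling Tree Property
iff `ST(X) < ω₁`: for every `δ > 0` there is a countable ordinal `α` such that `B_X` contains
no `δ`-`α`-sprawling tree. -/
theorem statement11 {X : Type*} [NormedAddCommGroup X] [NormedSpace ℝ X] [CompleteSpace X]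
    [TopologicalSpace.SeparableSpace X] :
    ¬ InfiniteSprawlingTreeProperty X ↔
      ∀ δ > (0 : ℝ), ∃ α < (Cardinal.aleph 1).ord,
        ¬ ∃ x : X, sprawlRoot (Metric.closedBall (0 : X) 1) δ α x := by
  constructor
  · intro hX δ hδ
    by_contra! h
    exact hX (.of_sprawlRoot hδ h)
  · rintro h ⟨δ, hδ, x, hx, htree⟩
    obtain ⟨α, -, hα⟩ := h δ hδ
    exact hα ⟨x [], sprawlRoot_of_tree (fun s => mem_closedBall_zero_iff.2 (hx s)) htree α []⟩
end
end

section
/- Let X and Y be Banach spaces. Assume that X fails the Infinite Tree Property and that Y bi-Lipschitz embeds into X. Then Y fails the Infinite Tree Property. -/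
open Metric Set Topology

noncomputable section

variable {X : Type*} [NormedAddCommGroup X] [NormedSpace ℝ X]

/-- `f : Y → X` is a bi-Lipschitz embedding. -/
def IsBiLipEmb {Y X : Type*} [NormedAddCommGroup Y] [NormedAddCommGroup X] (f : Y → X) : Prop :=
  ∃ A B : ℝ, 0 < A ∧ A ≤ B ∧
    ∀ u v : Y, A * ‖u - v‖ ≤ ‖f u - f v‖ ∧ ‖f u - f v‖ ≤ B * ‖u - v‖

/-- A nonempty subset of the unit ball each of whose points is the midpoint of two
`2δ`-separated points of the set yields an infinite tree. -/
theorem infiniteTreeProperty_of_midpoints {E : Type*} [NormedAddCommGroup E] [NormedSpace ℝ E]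
    {T : Set E} (hT : T.Nonempty) (hball : ∀ x ∈ T, ‖x‖ ≤ 1) {δ : ℝ} (hδ : 0 < δ)
    (hmid : ∀ x ∈ T, ∃ y ∈ T, ∃ z ∈ T, x = (2⁻¹ : ℝ) • (y + z) ∧ δ ≤ 2⁻¹ * ‖y - z‖) :
    InfiniteTreeProperty E := by
  obtain ⟨x₀, hx₀⟩ := hT
  have hstep : ∀ x : T, ∃ y z : T,
      (x : E) = (2⁻¹ : ℝ) • ((y : E) + z) ∧ δ ≤ 2⁻¹ * ‖(y : E) - z‖ := by
    rintro ⟨x, hx⟩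
    obtain ⟨y, hy, z, hz, h⟩ := hmid x hx
    exact ⟨⟨y, hy⟩, ⟨z, hz⟩, h⟩
  choose l r hlr using hstep
  refine ⟨δ, hδ, fun s => (s.foldl (fun t b => cond b (r t) (l t)) ⟨x₀, hx₀⟩ : T),
    fun s => hball _ (Subtype.property _), fun s => ?_⟩
  simpa only [List.foldl_append, List.foldl_cons, List.foldl_nil, cond_true, cond_false]
    using hlr _

/-- If `f` expands distances by at least `A`, then one of the two paths `a, a + u, a + u + v` and
`a, a + v, a + u + v` has increments under `f` that differ by at least `A * ‖u - v‖`. -/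
theorem le_norm_increment_sub_or {E F : Type*} [NormedAddCommGroup E]
    [NormedSpace ℝ E] [NormedAddCommGroup F] {f : F → E} {A : ℝ}
    (hf : ∀ u v : F, A * ‖u - v‖ ≤ ‖f u - f v‖) (a u v : F) :
    A * ‖u - v‖ ≤ ‖(f (a + u) - f a) - (f (a + u + v) - f (a + u))‖ ∨
      A * ‖u - v‖ ≤ ‖(f (a + v) - f a) - (f (a + v + u) - f (a + v))‖ := by
  by_contra! h
  have h₁ := hf (a + u) (a + v)
  rw [add_sub_add_left_eq_sub] at h₁
  have h₂ := norm_sub_le ((f (a + u) - f a) - (f (a + u + v) - f (a + u)))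
    ((f (a + v) - f a) - (f (a + v + u) - f (a + v)))
  have h₃ : (f (a + u) - f a) - (f (a + u + v) - f (a + u))
      - ((f (a + v) - f a) - (f (a + v + u) - f (a + v)))
      = (f (a + u) - f (a + v)) + (f (a + u) - f (a + v)) := by
    rw [add_right_comm a v u]; abel
  rw [h₃, ← two_smul ℝ, norm_smul] at h₂
  norm_num at h₂
  linarith [h.1, h.2]

/-- If `X` fails the Infinite Tree Property and `Y` bi-Lipschitz embeds into
`X`, then `Y` fails the Infinite Tree Property. -/
theorem statement15 {X Y : Type*} [NormedAddCommGroup X] [NormedSpace ℝ X] [CompleteSpace X]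
    [NormedAddCommGroup Y] [NormedSpace ℝ Y] [CompleteSpace Y]
    (hX : ¬ InfiniteTreeProperty X) (hemb : ∃ f : Y → X, IsBiLipEmb f) :
    ¬ InfiniteTreeProperty Y := by
  rintro ⟨δ, hδ, x, hx, htree⟩
  obtain ⟨f, A, B, hA, hAB, hf⟩ := hemb
  have hB : 0 < B := hA.trans_le hAB
  refine hX (infiniteTreeProperty_of_midpoints
    (T := {p | ∃ (a : Y) (c : ℝ) (s : List Bool), 0 < c ∧
      p = (B * c)⁻¹ • (f (a + c • x s) - f a)})
    ⟨_, 0, 1, [], one_pos, rfl⟩ ?_ (δ := A * δ / B) (by positivity) ?_)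
  · rintro _ ⟨a, c, s, hc, rfl⟩
    have h := (hf (a + c • x s) a).2
    rw [add_sub_cancel_left, norm_smul, Real.norm_of_nonneg hc.le] at h
    rw [norm_smul, Real.norm_of_nonneg (by positivity), inv_mul_le_iff₀ (by positivity)]
    refine h.trans ?_
    rw [← mul_assoc]
    exact mul_le_mul_of_nonneg_left (hx s) (by positivity)
  · rintro _ ⟨a, c, s, hc, rfl⟩
    obtain ⟨hmid, hsep⟩ := htree s
    have key : ∀ t t' : List Bool, x s = (2⁻¹ : ℝ) • (x t + x t') →
        A * (c * δ) ≤ ‖(f (a + (c / 2) • x t) - f a)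
          - (f (a + (c / 2) • x t + (c / 2) • x t') - f (a + (c / 2) • x t))‖ →
        ∃ y ∈ {p | ∃ (a : Y) (c : ℝ) (s : List Bool), 0 < c ∧
            p = (B * c)⁻¹ • (f (a + c • x s) - f a)},
          ∃ z ∈ {p | ∃ (a : Y) (c : ℝ) (s : List Bool), 0 < c ∧
            p = (B * c)⁻¹ • (f (a + c • x s) - f a)},
          (B * c)⁻¹ • (f (a + c • x s) - f a) = (2⁻¹ : ℝ) • (y + z) ∧
            A * δ / B ≤ 2⁻¹ * ‖y - z‖ := by
      intro t t' hm hd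
      refine ⟨_, ⟨a, c / 2, t, by positivity, rfl⟩,
        _, ⟨a + (c / 2) • x t, c / 2, t', by positivity, rfl⟩, ?_, ?_⟩
      · have hend : a + (c / 2) • x t + (c / 2) • x t' = a + c • x s := by
          rw [hm]; module
        rw [hend, ← smul_add, smul_smul, sub_add_sub_cancel']
        congr 1
        field_simp
      · rw [← smul_sub, norm_smul, Real.norm_of_nonneg (by positivity)]
        calc A * δ / B = 2⁻¹ * ((B * (c / 2))⁻¹ * (A * (c * δ))) := by field_simp
          _ ≤ _ := by gcongr
    have hscale : A * (c * δ) ≤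
        A * ‖(c / 2) • x (s ++ [false]) - (c / 2) • x (s ++ [true])‖ := by
      rw [← smul_sub, norm_smul, Real.norm_of_nonneg (by positivity), div_mul_eq_mul_div,
        mul_div_assoc, div_eq_inv_mul]
      gcongr
    rcases le_norm_increment_sub_or (fun u v => (hf u v).1) a ((c / 2) • x (s ++ [false]))
      ((c / 2) • x (s ++ [true])) with h | h
    · exact key _ _ hmid (hscale.trans h)
    · exact key _ _ (by rw [hmid, add_comm]) (hscale.trans h)
end
end
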